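/- Let K_n=(V,E⁺,E⁻) be a complete signed graph on n vertices that is (weakly) 2-anti-balanced with negative components V_1, V_2 satisfying |V_1| ≥ |V_2| ≥ ⌈(n+1)/3⌉. Then a_so(K_n) = 2⌈(|V_1|+1)/2⌉; moreover, for any S_1 ⊆ V_1 and S_2 ⊆ V_2 with |S_1| = |S_2| = ⌈(|V_1|+1)/2⌉, the set S_1∪S_2 is a minimum nonempty offensive alliance. -/

import Mathlib

/-- A signed graph on a vertex type `V`: a set of positive edges and a set of
negative edges, given as two simple graphs with disjoint edge sets. -/
structure SignedGraph (V : Type*) where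
  pos : SimpleGraph V
  neg : SimpleGraph V
  disj : ∀ u v : V, ¬ (pos.Adj u v ∧ neg.Adj u v)

namespace SignedGraph

variable {V : Type*}

/-- The positive neighborhood `N⁺(v)`. -/
def Np (G : SignedGraph V) (v : V) : Set V := {u | G.pos.Adj v u}

/-- The negative neighborhood `N⁻(v)`. -/
def Nn (G : SignedGraph V) (v : V) : Set V := {u | G.neg.Adj v u}

/-- The (open) neighborhood `N(v) = N⁺(v) ∪ N⁻(v)`. -/
def Nbr (G : SignedGraph V) (v : V) : Set V := G.Np v ∪ G.Nn v

/-- The positive degree `deg⁺(v)`. -/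
noncomputable def degp (G : SignedGraph V) (v : V) : ℕ := (G.Np v).ncard

/-- The negative degree `deg⁻(v)`. -/
noncomputable def degn (G : SignedGraph V) (v : V) : ℕ := (G.Nn v).ncard

/-- The positive degree with respect to a set `S`: `deg⁺_S(v) = |N⁺(v) ∩ S|`. -/
noncomputable def degpIn (G : SignedGraph V) (S : Set V) (v : V) : ℕ := (G.Np v ∩ S).ncard

/-- The negative degree with respect to a set `S`: `deg⁻_S(v) = |N⁻(v) ∩ S|`. -/
noncomputable def degnIn (G : SignedGraph V) (S : Set V) (v : V) : ℕ := (G.Nn v ∩ S).ncard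

/-- The boundary `∂S = (⋃_{v ∈ S} N(v)) \ S`. -/
def boundary (G : SignedGraph V) (S : Set V) : Set V := (⋃ v ∈ S, G.Nbr v) \ S

/-- `S` is an offensive alliance: every boundary vertex `v` satisfies
`deg⁻_S(v) ≥ deg⁺_S(v)` and `deg⁻_S(v) ≥ deg⁺_{S̄}(v) + 1`. -/
def IsOffensive (G : SignedGraph V) (S : Set V) : Prop :=
  ∀ v ∈ G.boundary S,
    G.degpIn S v ≤ G.degnIn S v ∧ G.degpIn Sᶜ v + 1 ≤ G.degnIn S v

/-- The offensive alliance number `a_so(G)`: the least size of a nonempty offensive alliance. -/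
noncomputable def aso (G : SignedGraph V) : ℕ :=
  sInf {n | ∃ S : Set V, S.Nonempty ∧ G.IsOffensive S ∧ S.ncard = n}

/-- `S` is a minimum-size nonempty offensive alliance. -/
def IsMinOffensive (G : SignedGraph V) (S : Set V) : Prop :=
  S.Nonempty ∧ G.IsOffensive S ∧
    ∀ T : Set V, T.Nonempty → G.IsOffensive T → S.ncard ≤ T.ncard

/-- The minimum positive degree `δ⁺(G)`. -/
noncomputable def minPosDeg (G : SignedGraph V) : ℕ := sInf (Set.range G.degp)

/-- The maximum negative degree `Δ⁻(G)`. -/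
noncomputable def maxNegDeg (G : SignedGraph V) : ℕ := sSup (Set.range G.degn)

/-- The underlying unsigned graph `(V, E⁺ ∪ E⁻)`. -/
def underlying (G : SignedGraph V) : SimpleGraph V := G.pos ⊔ G.neg

/-- `G` is connected if its underlying unsigned graph is connected. -/
def Connected (G : SignedGraph V) : Prop := G.underlying.Connected

/-- `G` is a complete signed graph that is (weakly) `k`-balanced with positive components
`P 0, …, P (k-1)`: the `P i` are nonempty, pairwise disjoint, cover `V`, the positive edges
are exactly the pairs of distinct vertices inside a common part, and the negative edges are
exactly the pairs of distinct vertices in no common part. -/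
def IsKBalanced (G : SignedGraph V) (k : ℕ) (P : Fin k → Set V) : Prop :=
  (∀ i, (P i).Nonempty) ∧
  (∀ i j : Fin k, i ≠ j → Disjoint (P i) (P j)) ∧
  (⋃ i, P i) = Set.univ ∧
  (∀ u v : V, G.pos.Adj u v ↔ u ≠ v ∧ ∃ i, u ∈ P i ∧ v ∈ P i) ∧
  (∀ u v : V, G.neg.Adj u v ↔ u ≠ v ∧ ¬ ∃ i, u ∈ P i ∧ v ∈ P i)

/-- `G` is a complete signed graph that is (weakly) `k`-anti-balanced with negative components
`P 0, …, P (k-1)`. -/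
def IsKAntiBalanced (G : SignedGraph V) (k : ℕ) (P : Fin k → Set V) : Prop :=
  (∀ i, (P i).Nonempty) ∧
  (∀ i j : Fin k, i ≠ j → Disjoint (P i) (P j)) ∧
  (⋃ i, P i) = Set.univ ∧
  (∀ u v : V, G.neg.Adj u v ↔ u ≠ v ∧ ∃ i, u ∈ P i ∧ v ∈ P i) ∧
  (∀ u v : V, G.pos.Adj u v ↔ u ≠ v ∧ ¬ ∃ i, u ∈ P i ∧ v ∈ P i)

/-- `V` can be partitioned into `t` classes such that vertices in a common class have the same
positive neighborhoods and the same negative neighborhoods (up to each other). -/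
def GoodSndPartition (G : SignedGraph V) (t : ℕ) : Prop :=
  ∃ C : Fin t → Set V,
    (⋃ i, C i) = Set.univ ∧
    (∀ i j : Fin t, i ≠ j → Disjoint (C i) (C j)) ∧
    ∀ i : Fin t, ∀ u ∈ C i, ∀ v ∈ C i,
      G.Np v \ {u} = G.Np u \ {v} ∧ G.Nn v \ {u} = G.Nn u \ {v}

/-- The signed neighborhood diversity `snd(G)`. -/
noncomputable def snd (G : SignedGraph V) : ℕ := sInf {t | G.GoodSndPartition t}

/-- The signed subgraph induced on a set `W` of vertices. -/
def restrict (G : SignedGraph V) (W : Set V) : SignedGraph W where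
  pos := G.pos.induce W
  neg := G.neg.induce W
  disj := fun u v h => G.disj u.val v.val h

end SignedGraph

namespace SignedGraph

variable {V : Type*} {G : SignedGraph V}

theorem IsKAntiBalanced.Nn_eq {k : ℕ} {P : Fin k → Set V} (h : G.IsKAntiBalanced k P)
    {i : Fin k} {v : V} (hv : v ∈ P i) : G.Nn v = P i \ {v} := by
  obtain ⟨-, hdisj, -, hneg, -⟩ := h
  ext u
  simp only [Nn, Set.mem_ofPred_eq, hneg, Set.mem_sdiff, Set.mem_singleton_iff]
  constructor
  · rintro ⟨hne, j, hvj, huj⟩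
    obtain rfl : i = j := by
      by_contra hij
      exact Set.disjoint_left.1 (hdisj i j hij) hv hvj
    exact ⟨huj, fun e => hne e.symm⟩
  · rintro ⟨hu, hne⟩
    exact ⟨fun e => hne e.symm, i, hv, hu⟩

theorem IsKAntiBalanced.Np_eq {k : ℕ} {P : Fin k → Set V} (h : G.IsKAntiBalanced k P)
    {i : Fin k} {v : V} (hv : v ∈ P i) : G.Np v = (P i)ᶜ := by
  obtain ⟨-, hdisj, -, -, hpos⟩ := h
  ext u
  simp only [Np, Set.mem_ofPred_eq, hpos, Set.mem_compl_iff]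
  constructor
  · rintro ⟨-, hn⟩ hu
    exact hn ⟨i, hv, hu⟩
  · intro hu
    refine ⟨fun e => hu (e ▸ hv), ?_⟩
    rintro ⟨j, hvj, huj⟩
    obtain rfl : i = j := by
      by_contra hij
      exact Set.disjoint_left.1 (hdisj i j hij) hv hvj
    exact hu huj

theorem IsKAntiBalanced.boundary_eq {k : ℕ} {P : Fin k → Set V} (h : G.IsKAntiBalanced k P)
    {S : Set V} (hS : S.Nonempty) : G.boundary S = Sᶜ := by
  ext v
  simp only [boundary, Set.mem_sdiff, Set.mem_iUnion, Set.mem_compl_iff, exists_prop,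
    and_iff_right_iff_imp]
  intro hv
  obtain ⟨u, hu⟩ := hS
  obtain ⟨i, hi⟩ := Set.mem_iUnion.1 (h.2.2.1 ▸ Set.mem_univ u : u ∈ ⋃ i, P i)
  refine ⟨u, hu, ?_⟩
  rw [Nbr, h.Nn_eq hi, h.Np_eq hi]
  by_cases hvi : v ∈ P i
  · exact Or.inr ⟨hvi, fun e => hv (e ▸ hu)⟩
  · exact Or.inl hvi

theorem IsKAntiBalanced.isOffensive_iff {k : ℕ} {P : Fin k → Set V}
    (h : G.IsKAntiBalanced k P) {S : Set V} (hS : S.Nonempty) :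
    G.IsOffensive S ↔ ∀ i, ¬ P i ⊆ S →
      ((P i)ᶜ ∩ S).ncard ≤ (P i ∩ S).ncard ∧
        ((P i)ᶜ \ S).ncard + 1 ≤ (P i ∩ S).ncard := by
  have key : ∀ i, ∀ v ∈ P i, v ∉ S → G.degnIn S v = (P i ∩ S).ncard := by
    intro i v hv hvS
    rw [degnIn, h.Nn_eq hv]
    congr 1
    ext u
    simp only [Set.mem_inter_iff, Set.mem_sdiff, Set.mem_singleton_iff]
    exact ⟨fun hu => ⟨hu.1.1, hu.2⟩, fun hu => ⟨⟨hu.1, fun e => hvS (e ▸ hu.2)⟩, hu.2⟩⟩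
  rw [IsOffensive, h.boundary_eq hS]
  constructor
  · intro H i hi
    obtain ⟨v, hv, hvS⟩ := Set.not_subset.1 hi
    have := H v hvS
    rwa [key i v hv hvS, degpIn, degpIn, h.Np_eq hv] at this
  · intro H v hvS
    obtain ⟨i, hv⟩ := Set.mem_iUnion.1 (h.2.2.1 ▸ Set.mem_univ v : v ∈ ⋃ i, P i)
    rw [key i v hv hvS, degpIn, degpIn, h.Np_eq hv]
    exact H i (Set.not_subset.2 ⟨v, hv, hvS⟩)

theorem IsKAntiBalanced.compl_zero {P : Fin 2 → Set V} (h : G.IsKAntiBalanced 2 P) :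
    (P 0)ᶜ = P 1 := by
  have hd := h.2.1 0 1 (by decide)
  have hu : P 0 ∪ P 1 = Set.univ := by
    rw [← h.2.2.1]; ext v; simp [Fin.exists_fin_two]
  exact (IsCompl.of_eq hd.eq_bot hu).compl_eq

theorem IsKAntiBalanced.isOffensive_iff_two [Finite V] {P : Fin 2 → Set V}
    (h : G.IsKAntiBalanced 2 P) {S : Set V} (hS : S.Nonempty) :
    G.IsOffensive S ↔
      ((P 0 ∩ S).ncard < (P 0).ncard → (P 1 ∩ S).ncard ≤ (P 0 ∩ S).ncard ∧
        (P 1).ncard + 1 ≤ (P 0 ∩ S).ncard + (P 1 ∩ S).ncard) ∧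
      ((P 1 ∩ S).ncard < (P 1).ncard → (P 0 ∩ S).ncard ≤ (P 1 ∩ S).ncard ∧
        (P 0).ncard + 1 ≤ (P 0 ∩ S).ncard + (P 1 ∩ S).ncard) := by
  have hlt : ∀ i, ¬ P i ⊆ S ↔ (P i ∩ S).ncard < (P i).ncard := by
    intro i
    rw [← Set.inter_eq_left]
    constructor
    · exact fun hne => Set.ncard_lt_ncard (Set.inter_subset_left.ssubset_of_ne hne)
    · exact fun hl he => by rw [he] at hl; exact hl.false
  have h0 := Set.ncard_inter_add_ncard_sdiff_eq_ncard (P 0) S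
  have h1 := Set.ncard_inter_add_ncard_sdiff_eq_ncard (P 1) S
  have hc : (P 1)ᶜ = P 0 := by rw [← h.compl_zero, compl_compl]
  rw [h.isOffensive_iff hS, Fin.forall_fin_two, hlt, hlt, h.compl_zero, hc]
  omega

theorem IsKAntiBalanced.ncard_inter_add {P : Fin 2 → Set V} [Finite V]
    (h : G.IsKAntiBalanced 2 P) (S : Set V) :
    (P 0 ∩ S).ncard + (P 1 ∩ S).ncard = S.ncard := by
  rw [← Set.ncard_inter_add_ncard_sdiff_eq_ncard S (P 0), Set.sdiff_eq, h.compl_zero,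
    Set.inter_comm S, Set.inter_comm S]

end SignedGraph

theorem signed_two_anti_balanced_aso {V : Type*} [Fintype V]
    (G : SignedGraph V) (P : Fin 2 → Set V)
    (hanti : G.IsKAntiBalanced 2 P)
    (hsort : (P 1).ncard ≤ (P 0).ncard)
    (hbig : (Fintype.card V + 3) / 3 ≤ (P 1).ncard) :
    G.aso = 2 * (((P 0).ncard + 2) / 2) ∧
      ∀ S1 S2 : Set V, S1 ⊆ P 0 → S2 ⊆ P 1 →
        S1.ncard = ((P 0).ncard + 2) / 2 → S2.ncard = ((P 0).ncard + 2) / 2 →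
        G.IsMinOffensive (S1 ∪ S2) := by
  have hcard : (P 0).ncard + (P 1).ncard = Fintype.card V := by
    rw [← Nat.card_eq_fintype_card, ← hanti.compl_zero, Set.ncard_add_ncard_compl]
  have lower : ∀ T : Set V, T.Nonempty → G.IsOffensive T →
      2 * (((P 0).ncard + 2) / 2) ≤ T.ncard := by
    intro T hT hoff
    rw [hanti.isOffensive_iff_two hT] at hoff
    have hadd := hanti.ncard_inter_add T
    have h0 : (P 0 ∩ T).ncard ≤ (P 0).ncard := Set.ncard_le_ncard Set.inter_subset_left
    have h1 : (P 1 ∩ T).ncard ≤ (P 1).ncard := Set.ncard_le_ncard Set.inter_subset_left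
    omega
  have upper : ∀ S1 S2 : Set V, S1 ⊆ P 0 → S2 ⊆ P 1 →
      S1.ncard = ((P 0).ncard + 2) / 2 → S2.ncard = ((P 0).ncard + 2) / 2 →
      (S1 ∪ S2).Nonempty ∧ G.IsOffensive (S1 ∪ S2) ∧
        (S1 ∪ S2).ncard = 2 * (((P 0).ncard + 2) / 2) := by
    intro S1 S2 h1 h2 c1 c2
    have hd : Disjoint (P 0) (P 1) := hanti.2.1 0 1 (by decide)
    have e0 : P 0 ∩ (S1 ∪ S2) = S1 := by
      rw [Set.inter_union_distrib_left, Set.inter_eq_right.2 h1,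
        (hd.mono_right h2).inter_eq, Set.union_empty]
    have e1 : P 1 ∩ (S1 ∪ S2) = S2 := by
      rw [Set.inter_union_distrib_left, Set.inter_eq_right.2 h2,
        (hd.symm.mono_right h1).inter_eq, Set.empty_union]
    have hne : (S1 ∪ S2).Nonempty :=
      (Set.nonempty_of_ncard_ne_zero (s := S1) (by omega)).inl
    have hadd := hanti.ncard_inter_add (S1 ∪ S2)
    refine ⟨hne, ?_, ?_⟩
    · rw [hanti.isOffensive_iff_two hne, e0, e1]
      omega
    · rw [e0, e1] at hadd
      omega
  constructor
  · obtain ⟨S1, h1, c1⟩ := Set.exists_subset_card_eq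
      (show ((P 0).ncard + 2) / 2 ≤ (P 0).ncard by omega)
    obtain ⟨S2, h2, c2⟩ := Set.exists_subset_card_eq
      (show ((P 0).ncard + 2) / 2 ≤ (P 1).ncard by omega)
    refine IsLeast.csInf_eq ⟨⟨S1 ∪ S2, upper S1 S2 h1 h2 c1 c2⟩, ?_⟩
    rintro n ⟨T, hT, hoff, rfl⟩
    exact lower T hT hoff
  · intro S1 S2 h1 h2 c1 c2
    obtain ⟨hne, hoff, hc⟩ := upper S1 S2 h1 h2 c1 c2
    exact ⟨hne, hoff, fun T hT hT' => hc ▸ lower T hT hT'⟩
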